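/- Let g ≥ 3. There exist constants c = c(g) > 0 and K_0 = K_0(g) such that for all integers K ≥ K_0, every integer k with |k − μ_K| ≤ C_g, and every θ in the minor arcs 𝔪 := (ℝ/ℤ) ∖ 𝔐, one has |f_k(θ)| ≤ c · g^K K^{−5/4}. -/

import Mathlib

set_option autoImplicit false

noncomputable section

/-- `e(x) = exp(2πix)`. -/
def eC (x : ℝ) : ℂ := Complex.exp (2 * Real.pi * Complex.I * x)

/-- Base-`g` digit sum. -/
def digitSum (g n : ℕ) : ℕ := (Nat.digits g n).sum

/-- `S_g(k)`: naturals below `g^K` with base-`g` digit sum `k`. -/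
def Sset (g K : ℕ) (k : ℤ) : Finset ℕ :=
  (Finset.range (g ^ K)).filter fun n => (digitSum g n : ℤ) = k

/-- The exponential sum `f_k(θ) = Σ_{n ∈ S_g(k)} e(nθ)`. -/
def fsum (g K : ℕ) (k : ℤ) (θ : ℝ) : ℂ := ∑ n ∈ Sset g K k, eC ((n : ℝ) * θ)

/-- The average digit sum `μ_K = (g-1)K/2`. -/
def muK (g K : ℕ) : ℝ := ((g : ℝ) - 1) * K / 2

/-- `C_g = g(g-1) ∏_{p ≤ 10g², p prime} p`. -/
def Cg (g : ℕ) : ℕ := g * (g - 1) * ∏ p ∈ (Finset.Iic (10 * g ^ 2)).filter Nat.Prime, p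

/-- The major-arc width `ε = K^{3/4} g^{-K} / (g-1)`. -/
def epsK (g K : ℕ) : ℝ := (K : ℝ) ^ ((3 : ℝ) / 4) * ((g : ℝ) ^ K)⁻¹ / ((g : ℝ) - 1)

/-- A real number `θ` represents a point of the minor arcs `𝔪 = (ℝ/ℤ) ∖ 𝔐`, where
`𝔐 = ⋃_{j=0}^{g-2} [j/(g-1) - ε, j/(g-1) + ε] ⊂ ℝ/ℤ`: equivalently, `θ` avoids all the
real translates `[j/(g-1) - ε, j/(g-1) + ε]`, `j ∈ ℤ`, of the major arcs. -/
def inMinorArcs (g K : ℕ) (θ : ℝ) : Prop :=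
  ∀ j : ℤ, epsK g K < |θ - (j : ℝ) / ((g : ℝ) - 1)|

/-! ### Additive characters and the normalised Dirichlet-type kernel -/

lemma eC_add (x y : ℝ) : eC (x + y) = eC x * eC y := by
  unfold eC
  rw [← Complex.exp_add]
  push_cast
  ring_nf

lemma eC_eq_exp_ofReal_mul_I (x : ℝ) : eC x = Complex.exp ((2 * Real.pi * x : ℝ) * Complex.I) := by
  unfold eC
  push_cast
  ring_nf

lemma norm_eC (x : ℝ) : ‖eC x‖ = 1 := by
  rw [eC_eq_exp_ofReal_mul_I, Complex.norm_exp_ofReal_mul_I]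

lemma eC_intCast (n : ℤ) : eC n = 1 := by
  unfold eC
  rw [Complex.exp_eq_one_iff]
  exact ⟨n, by push_cast; ring⟩

lemma eC_zero : eC 0 = 1 := by simpa using eC_intCast 0

lemma eC_add_intCast (x : ℝ) (n : ℤ) : eC (x + n) = eC x := by
  rw [eC_add, eC_intCast, mul_one]

lemma eC_sum {ι : Type*} (s : Finset ι) (f : ι → ℝ) : eC (∑ i ∈ s, f i) = ∏ i ∈ s, eC (f i) := by
  classical
  induction s using Finset.induction_on with
  | empty => simp [eC_zero]
  | insert a s ha ih => rw [Finset.sum_insert ha, Finset.prod_insert ha, eC_add, ih]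

lemma continuous_eC : Continuous eC := by
  unfold eC
  fun_prop

lemma norm_eC_sub_one_le (x : ℝ) : ‖eC x - 1‖ ≤ 2 * Real.pi * |x| := by
  rw [eC_eq_exp_ofReal_mul_I, mul_comm]
  refine (Real.norm_exp_I_mul_ofReal_sub_one_le).trans ?_
  rw [Real.norm_eq_abs, abs_mul, abs_of_pos Real.two_pi_pos]

lemma norm_eC_sub_one (x : ℝ) : ‖eC x - 1‖ = 2 * |Real.sin (Real.pi * x)| := by
  rw [eC_eq_exp_ofReal_mul_I, mul_comm, Complex.norm_exp_I_mul_ofReal_sub_one, Real.norm_eq_abs,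
    abs_mul, abs_two]
  congr 3
  ring

/-- Signed distance from `x` to a nearest integer. -/
def centred (x : ℝ) : ℝ := x - round x

lemma abs_centred_le_half (x : ℝ) : |centred x| ≤ 1 / 2 := abs_sub_round x

lemma abs_centred_le (x : ℝ) (n : ℤ) : |centred x| ≤ |x - n| := round_le x n

lemma abs_centred_le_abs (x : ℝ) : |centred x| ≤ |x| := by simpa using abs_centred_le x 0

lemma abs_centred_of_abs_le_half {x : ℝ} (hx : |x| ≤ 1 / 2) : |centred x| = |x| := by
  apply le_antisymm (abs_centred_le_abs x)
  unfold centred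
  by_cases h : round x = 0
  · simp [h]
  · have h1 : (1 : ℝ) ≤ |(round x : ℝ)| := by
      rw [← Int.cast_abs]
      exact_mod_cast Int.one_le_abs h
    have h2 := abs_sub_abs_le_abs_sub (round x : ℝ) x
    rw [abs_sub_comm] at h2
    linarith

lemma two_mul_abs_centred_le_abs_sin (x : ℝ) : 2 * |centred x| ≤ |Real.sin (Real.pi * x)| := by
  have h := Real.mul_abs_le_abs_sin (x := Real.pi * centred x) (by
    rw [abs_mul, abs_of_pos Real.pi_pos]
    have := abs_centred_le_half x
    nlinarith [Real.pi_pos])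
  have h2 : |Real.sin (Real.pi * centred x)| = |Real.sin (Real.pi * x)| := by
    have : Real.pi * centred x = Real.pi * x - round x * Real.pi := by unfold centred; ring
    rw [this, Real.sin_sub_int_mul_pi, abs_mul]
    simp [abs_zpow]
  rw [h2, abs_mul, abs_of_pos Real.pi_pos] at h
  calc 2 * |centred x| = 2 / Real.pi * (Real.pi * |centred x|) := by
        field_simp
    _ ≤ _ := h

/-- The sum of additive characters over one digit. -/
def digitKernel (g : ℕ) (x : ℝ) : ℂ := ∑ d ∈ Finset.range g, eC (d * x)

/-- The digit kernel, centred so that it is real and normalised to be `1` at the origin. -/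
def realKernel (g : ℕ) (x : ℝ) : ℝ :=
  (∑ d ∈ Finset.range g, Real.cos (Real.pi * ((g : ℝ) - 1 - 2 * d) * x)) / g

lemma digitKernel_eq {g : ℕ} (hg : 0 < g) (x : ℝ) :
    digitKernel g x = eC (((g : ℝ) - 1) / 2 * x) * ((g : ℝ) * realKernel g x : ℝ) := by
  have hg0 : (g : ℝ) ≠ 0 := by positivity
  set a : ℕ → ℝ := fun d => (d - ((g : ℝ) - 1) / 2) * x with ha
  have h1 : digitKernel g x = eC (((g : ℝ) - 1) / 2 * x) * ∑ d ∈ Finset.range g, eC (a d) := by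
    rw [digitKernel, Finset.mul_sum]
    refine Finset.sum_congr rfl fun d _ => ?_
    rw [← eC_add]
    congr 1
    simp only [ha]
    ring
  have h2 : ∑ d ∈ Finset.range g, eC (a d) = ∑ d ∈ Finset.range g, eC (-a d) := by
    rw [← Finset.sum_range_reflect]
    refine Finset.sum_congr rfl fun d hd => ?_
    rw [Finset.mem_range] at hd
    congr 1
    have : ((g - 1 - d : ℕ) : ℝ) = g - 1 - d := by
      rw [Nat.cast_sub (by omega), Nat.cast_sub (by omega)]
      simp
    simp only [ha, this]
    ring
  rw [h1]
  congr 1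
  have h3 : ∀ d : ℕ, eC (a d) + eC (-a d) =
      2 * (Real.cos (Real.pi * ((g : ℝ) - 1 - 2 * d) * x) : ℂ) := by
    intro d
    rw [eC_eq_exp_ofReal_mul_I, eC_eq_exp_ofReal_mul_I, Complex.ofReal_cos,
      Complex.two_cos]
    simp only [ha]
    rw [add_comm]
    congr 2 <;> · push_cast; ring
  have h4 : 2 * ∑ d ∈ Finset.range g, eC (a d) = 2 * (((g : ℝ) * realKernel g x : ℝ) : ℂ) := by
    calc 2 * ∑ d ∈ Finset.range g, eC (a d)
        = ∑ d ∈ Finset.range g, eC (a d) + ∑ d ∈ Finset.range g, eC (-a d) := by rw [← h2, two_mul]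
      _ = ∑ d ∈ Finset.range g, 2 * (Real.cos (Real.pi * ((g : ℝ) - 1 - 2 * d) * x) : ℂ) := by
        rw [← Finset.sum_add_distrib]
        exact Finset.sum_congr rfl fun d _ => h3 d
      _ = _ := by rw [realKernel, mul_div_cancel₀ _ hg0, Complex.ofReal_sum, Finset.mul_sum]
  exact mul_left_cancel₀ two_ne_zero h4

lemma norm_digitKernel {g : ℕ} (hg : 0 < g) (x : ℝ) :
    ‖digitKernel g x‖ = g * |realKernel g x| := by
  rw [digitKernel_eq hg, norm_mul, norm_eC, one_mul, Complex.norm_real, Real.norm_eq_abs, abs_mul,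
    Nat.abs_cast]

lemma digitKernel_add_intCast (g : ℕ) (x : ℝ) (n : ℤ) :
    digitKernel g (x + n) = digitKernel g x := by
  unfold digitKernel
  refine Finset.sum_congr rfl fun d _ => ?_
  have := eC_add_intCast (d * x) (d * n)
  rw [← this]
  push_cast
  ring_nf

lemma continuous_digitKernel (g : ℕ) : Continuous (digitKernel g) := by
  unfold digitKernel
  exact continuous_finsetSum _ fun d _ => continuous_eC.comp (by fun_prop)

lemma abs_realKernel_le {g : ℕ} (hg : 2 ≤ g) (x : ℝ) :
    |realKernel g x| ≤ Real.exp (-(4 / g * centred x ^ 2)) := by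
  have hg0 : (0 : ℝ) < g := by positivity
  obtain ⟨m, rfl⟩ := Nat.exists_eq_add_of_le hg
  have h1 : ‖digitKernel (2 + m) x‖ ≤ ‖1 + eC x‖ + m := by
    rw [digitKernel, Finset.sum_range_add]
    refine (norm_add_le _ _).trans (add_le_add ?_ ?_)
    · simp [Finset.sum_range_succ, eC_zero]
    · refine (norm_sum_le _ _).trans ?_
      simp [norm_eC]
  have h2 : ‖1 + eC x‖ ^ 2 = 4 - ‖eC x - 1‖ ^ 2 := by
    have := parallelogram_law_with_norm ℝ (1 : ℂ) (eC x)
    rw [norm_eC, norm_one, norm_sub_rev] at this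
    nlinarith
  rw [norm_eC_sub_one] at h2
  have h3 := two_mul_abs_centred_le_abs_sin x
  have h4 : ‖1 + eC x‖ ≤ 2 - 4 * centred x ^ 2 := by
    have h5 : 4 * centred x ^ 2 ≤ Real.sin (Real.pi * x) ^ 2 := by
      rw [← sq_abs (Real.sin _), ← sq_abs (centred x)]
      nlinarith [abs_nonneg (centred x)]
    have h6 : centred x ^ 2 ≤ 1 / 4 := by
      rw [← sq_abs]
      nlinarith [abs_nonneg (centred x), abs_centred_le_half x]
    rw [mul_pow, sq_abs] at h2
    apply le_of_sq_le_sq _ (by linarith)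
    nlinarith [sq_nonneg (centred x)]
  rw [norm_digitKernel (by omega)] at h1
  have h7 : |realKernel (2 + m) x| ≤ 1 - 4 / ((2 + m : ℕ) : ℝ) * centred x ^ 2 := by
    rw [← mul_le_mul_iff_right₀ hg0, mul_sub, ← mul_assoc, mul_div_cancel₀ _ hg0.ne']
    push_cast at *
    linarith
  refine h7.trans ?_
  have := Real.add_one_le_exp (-(4 / ((2 + m : ℕ) : ℝ) * centred x ^ 2))
  linarith

lemma abs_realKernel_le_one {g : ℕ} (hg : 2 ≤ g) (x : ℝ) : |realKernel g x| ≤ 1 := by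
  refine (abs_realKernel_le hg x).trans (Real.exp_le_one_iff.2 ?_)
  have : 0 ≤ 4 / (g : ℝ) * centred x ^ 2 := by positivity
  linarith

lemma realKernel_zero {g : ℕ} (hg : 0 < g) : realKernel g 0 = 1 := by
  have hg0 : (g : ℝ) ≠ 0 := by positivity
  simp [realKernel, hg0]

lemma realKernel_neg (g : ℕ) (x : ℝ) : realKernel g (-x) = realKernel g x := by
  simp [realKernel]

lemma abs_average_le {g : ℕ} (hg : 0 < g) {f : ℕ → ℝ} {C : ℝ} (h : ∀ d < g, |f d| ≤ C) :
    |(∑ d ∈ Finset.range g, f d) / g| ≤ C := by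
  have hg0 : (0 : ℝ) < g := by positivity
  rw [abs_div, Nat.abs_cast, div_le_iff₀ hg0]
  refine (Finset.abs_sum_le_sum_abs _ _).trans ?_
  refine (Finset.sum_le_card_nsmul _ _ C fun d hd => h d (Finset.mem_range.1 hd)).trans ?_
  simp [mul_comm]

lemma abs_frequency_mul_le {g d : ℕ} (hd : d < g) (x : ℝ) :
    |Real.pi * ((g : ℝ) - 1 - 2 * d) * x| ≤ Real.pi * g * |x| := by
  have hd' : (d : ℝ) + 1 ≤ g := by exact_mod_cast hd
  have hd0 : (0 : ℝ) ≤ d := by positivity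
  rw [abs_mul, abs_mul, abs_of_pos Real.pi_pos]
  gcongr
  rw [abs_le]
  constructor <;> linarith

lemma abs_cos_add_sub_cos_le (a t : ℝ) : |Real.cos (a + t) - Real.cos a| ≤ |t| := by
  simpa using Real.abs_cos_sub_cos_le (a + t) a

lemma abs_cos_sub_one_le_sq (t : ℝ) : |Real.cos t - 1| ≤ t ^ 2 / 2 := by
  rw [abs_le]
  constructor
  · linarith [Real.one_sub_sq_div_two_le_cos (x := t)]
  · linarith [Real.cos_le_one t, sq_nonneg t]

lemma abs_realKernel_add_sub_le {g : ℕ} (hg : 0 < g) (x t : ℝ) :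
    |realKernel g (x + t) - realKernel g x| ≤ Real.pi * g * |t| := by
  rw [realKernel, realKernel, ← sub_div, ← Finset.sum_sub_distrib]
  refine abs_average_le hg fun d hd => ?_
  rw [mul_add]
  exact (abs_cos_add_sub_cos_le _ _).trans (abs_frequency_mul_le hd t)

lemma abs_realKernel_second_difference_le {g : ℕ} (hg : 0 < g) (x t : ℝ) :
    |realKernel g (x + t) + realKernel g (x - t) - 2 * realKernel g x| ≤
      (Real.pi * g * |t|) ^ 2 := by
  have : realKernel g (x + t) + realKernel g (x - t) - 2 * realKernel g x =
      (∑ d ∈ Finset.range g, 2 * Real.cos (Real.pi * ((g : ℝ) - 1 - 2 * d) * x) *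
        (Real.cos (Real.pi * ((g : ℝ) - 1 - 2 * d) * t) - 1)) / g := by
    rw [realKernel, realKernel, realKernel, ← add_div, mul_div_assoc', ← sub_div, Finset.mul_sum,
      ← Finset.sum_add_distrib, ← Finset.sum_sub_distrib]
    congr 1
    refine Finset.sum_congr rfl fun d _ => ?_
    rw [mul_add _ x t, mul_sub _ x t, Real.cos_add, Real.cos_sub]
    ring
  rw [this]
  refine abs_average_le hg fun d hd => ?_
  have h1 := abs_cos_sub_one_le_sq (Real.pi * ((g : ℝ) - 1 - 2 * d) * t)
  have h2 := abs_frequency_mul_le hd t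
  have h3 := Real.abs_cos_le_one (Real.pi * ((g : ℝ) - 1 - 2 * d) * x)
  rw [← sq_abs] at h1
  rw [abs_mul, abs_mul, abs_two]
  calc _ ≤ 2 * 1 * (|Real.pi * ((g : ℝ) - 1 - 2 * d) * t| ^ 2 / 2) := by gcongr
    _ = |Real.pi * ((g : ℝ) - 1 - 2 * d) * t| ^ 2 := by ring
    _ ≤ _ := by gcongr

lemma abs_realKernel_add_sub_mul_le {g : ℕ} (hg : 0 < g) (x y : ℝ) :
    |realKernel g (x + y) - realKernel g x * realKernel g y| ≤
      3 * (Real.pi * g) ^ 2 * (|x| * |y|) := by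
  have hg0 : (g : ℝ) ≠ 0 := by positivity
  have h1 : |realKernel g (x + y) - realKernel g x - realKernel g y + 1| ≤
      2 * (Real.pi * g) ^ 2 * (|x| * |y|) := by
    have : realKernel g (x + y) - realKernel g x - realKernel g y + 1 =
        (∑ d ∈ Finset.range g, ((Real.cos (Real.pi * ((g : ℝ) - 1 - 2 * d) * x) - 1) *
          (Real.cos (Real.pi * ((g : ℝ) - 1 - 2 * d) * y) - 1) -
          Real.sin (Real.pi * ((g : ℝ) - 1 - 2 * d) * x) *
          Real.sin (Real.pi * ((g : ℝ) - 1 - 2 * d) * y))) / g := by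
      have h1 : (1 : ℝ) = (∑ d ∈ Finset.range g, (1 : ℝ)) / g := by simp [hg0]
      rw [h1, realKernel, realKernel, realKernel, ← sub_div, ← sub_div, ← add_div,
        ← Finset.sum_sub_distrib, ← Finset.sum_sub_distrib, ← Finset.sum_add_distrib, ← h1]
      congr 1
      refine Finset.sum_congr rfl fun d _ => ?_
      rw [mul_add, Real.cos_add]
      ring
    rw [this]
    refine abs_average_le hg fun d hd => ?_
    set a := Real.pi * ((g : ℝ) - 1 - 2 * d) * x
    set b := Real.pi * ((g : ℝ) - 1 - 2 * d) * y
    have ha : |a| ≤ Real.pi * g * |x| := abs_frequency_mul_le hd x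
    have hb : |b| ≤ Real.pi * g * |y| := abs_frequency_mul_le hd y
    have ca : |Real.cos a - 1| ≤ |a| := by simpa using abs_cos_add_sub_cos_le 0 a
    have cb : |Real.cos b - 1| ≤ |b| := by simpa using abs_cos_add_sub_cos_le 0 b
    have sa : |Real.sin a| ≤ |a| := Real.abs_sin_le_abs
    have sb : |Real.sin b| ≤ |b| := Real.abs_sin_le_abs
    refine (abs_sub _ _).trans ?_
    rw [abs_mul, abs_mul]
    calc _ ≤ |a| * |b| + |a| * |b| := by gcongr
      _ = 2 * (|a| * |b|) := by ring
      _ ≤ 2 * ((Real.pi * g * |x|) * (Real.pi * g * |y|)) := by gcongr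
      _ = _ := by ring
  have hx := abs_realKernel_add_sub_le hg 0 x
  have hy := abs_realKernel_add_sub_le hg 0 y
  rw [zero_add, realKernel_zero hg] at hx hy
  have h2 : realKernel g (x + y) - realKernel g x * realKernel g y =
      (realKernel g (x + y) - realKernel g x - realKernel g y + 1) -
        (realKernel g x - 1) * (realKernel g y - 1) := by ring
  rw [h2]
  refine (abs_sub _ _).trans ?_
  rw [abs_mul]
  calc _ ≤ 2 * (Real.pi * g) ^ 2 * (|x| * |y|) + (Real.pi * g * |x|) * (Real.pi * g * |y|) := by
        gcongr
    _ = _ := by ring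

lemma half_le_realKernel {g : ℕ} (hg : 0 < g) {x : ℝ} (hx : |x| ≤ 1 / (8 * g)) :
    1 / 2 ≤ realKernel g x := by
  have hg0 : (0 : ℝ) < g := by positivity
  have h := abs_realKernel_add_sub_le hg 0 x
  rw [zero_add, realKernel_zero hg] at h
  have h2 : Real.pi * g * |x| ≤ 1 / 2 := by
    calc Real.pi * g * |x| ≤ 4 * g * (1 / (8 * g)) := by
          gcongr
          exact Real.pi_le_four
      _ = 1 / 2 := by field_simp; norm_num
  linarith [(abs_le.1 h).1]

/-! ### The exponential sum as an integral of a product -/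

lemma sum_range_mul_eq_sum_sum {M : Type*} [AddCommMonoid M] (f : ℕ → M) (g m : ℕ) :
    ∑ n ∈ Finset.range (g * m), f n =
      ∑ q ∈ Finset.range m, ∑ d ∈ Finset.range g, f (d + g * q) := by
  induction m with
  | zero => simp
  | succ m ih =>
    rw [Finset.sum_range_succ, ← ih, mul_add, mul_one, Finset.sum_range_add]
    simp only [add_comm]

lemma digitSum_add_mul {g d : ℕ} (hg : 2 ≤ g) (hd : d < g) (q : ℕ) :
    digitSum g (d + g * q) = d + digitSum g q := by
  by_cases h : d ≠ 0 ∨ q ≠ 0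
  · rw [digitSum, Nat.digits_add g (by omega) d q hd h, List.sum_cons, digitSum]
  · push Not at h
    simp [h.1, h.2, digitSum]

lemma sum_eC_digitSum_mul_add {g : ℕ} (hg : 2 ≤ g) (α : ℝ) (K : ℕ) (θ : ℝ) :
    ∑ n ∈ Finset.range (g ^ K), eC (digitSum g n * α + n * θ) =
      ∏ i ∈ Finset.range K, digitKernel g (α + (g : ℝ) ^ i * θ) := by
  induction K generalizing θ with
  | zero => simp [digitSum, eC_zero]
  | succ K ih =>
    rw [pow_succ', sum_range_mul_eq_sum_sum, Finset.prod_range_succ']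
    have h : ∀ q : ℕ, ∑ d ∈ Finset.range g,
        eC (digitSum g (d + g * q) * α + ((d + g * q : ℕ) : ℝ) * θ) =
        eC (digitSum g q * α + q * (g * θ)) * digitKernel g (α + (g : ℝ) ^ 0 * θ) := by
      intro q
      rw [digitKernel, Finset.mul_sum]
      refine Finset.sum_congr rfl fun d hd => ?_
      rw [digitSum_add_mul hg (Finset.mem_range.1 hd), ← eC_add]
      congr 1
      push_cast
      ring
    rw [Finset.sum_congr rfl fun q _ => h q, ← Finset.sum_mul, ih]
    congr 1
    refine Finset.prod_congr rfl fun i _ => ?_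
    rw [pow_succ, mul_assoc]

lemma integral_eC_intCast_mul (n : ℤ) : ∫ α in (0 : ℝ)..1, eC (n * α) = if n = 0 then 1 else 0 := by
  split_ifs with h
  · simp [h, eC_zero]
  · have hc : 2 * Real.pi * Complex.I * n ≠ 0 := by
      have : (n : ℂ) ≠ 0 := by exact_mod_cast h
      have := Complex.two_pi_I_ne_zero
      positivity
    have h1 : ∀ α : ℝ, eC (n * α) = Complex.exp (2 * Real.pi * Complex.I * n * α) := by
      intro α
      unfold eC
      push_cast
      ring_nf
    simp only [h1]
    rw [integral_exp_mul_complex hc]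
    have h2 := eC_intCast n
    unfold eC at h2
    push_cast at h2
    simp [h2]

lemma fsum_eq_integral {g : ℕ} (hg : 2 ≤ g) (K : ℕ) (k : ℤ) (θ : ℝ) :
    fsum g K k θ = ∫ α in (0 : ℝ)..1,
      eC (-k * α) * ∏ i ∈ Finset.range K, digitKernel g (α + (g : ℝ) ^ i * θ) := by
  have h : ∀ α : ℝ, eC (-k * α) * ∏ i ∈ Finset.range K, digitKernel g (α + (g : ℝ) ^ i * θ) =
      ∑ n ∈ Finset.range (g ^ K), eC (n * θ) * eC (((digitSum g n - k : ℤ) : ℝ) * α) := by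
    intro α
    rw [← sum_eC_digitSum_mul_add hg, Finset.mul_sum]
    refine Finset.sum_congr rfl fun n _ => ?_
    rw [← eC_add, ← eC_add]
    congr 1
    push_cast
    ring
  simp only [h]
  rw [intervalIntegral.integral_finsetSum]
  · rw [fsum, Sset, Finset.sum_filter]
    refine Finset.sum_congr rfl fun n _ => ?_
    rw [intervalIntegral.integral_const_mul, integral_eC_intCast_mul]
    simp [sub_eq_zero]
  · intro n _
    exact (continuous_const.mul (continuous_eC.comp (by fun_prop))).intervalIntegrable _ _

lemma norm_integral_le_of_symmetrised_bound {m : ℕ} (hm : 0 < m) {F : ℝ → ℂ} (hF : Continuous F)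
    (hper : Function.Periodic F 1) {b : ℝ → ℝ} (hb : Continuous b)
    (h : ∀ j < m, ∀ β : ℝ, 0 ≤ β → β ≤ 1 / (2 * m) →
      ‖F (j / m + β) + F (j / m - β)‖ ≤ b β) :
    ‖∫ α in (0 : ℝ)..1, F α‖ ≤ m * ∫ β in (0 : ℝ)..(1 / (2 * m)), b β := by
  have hm0 : (m : ℝ) ≠ 0 := by positivity
  set w : ℝ := 1 / (2 * m) with hw
  have hw0 : 0 ≤ w := by positivity
  have h1 : ∫ α in (0 : ℝ)..1, F α =
      ∑ j ∈ Finset.range m, ∫ α in ((j : ℝ) / m - w)..(((j + 1 : ℕ) : ℝ) / m - w), F α := by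
    rw [intervalIntegral.sum_integral_adjacent_intervals (a := fun j : ℕ => (j : ℝ) / m - w)
      fun _ _ => hF.intervalIntegrable _ _]
    have := hper.intervalIntegral_add_eq 0 (((0 : ℕ) : ℝ) / m - w)
    rw [zero_add] at this
    rw [this]
    congr 1
    field_simp
    simp
    ring
  have h2 : ∀ j : ℕ, ∫ α in ((j : ℝ) / m - w)..(((j + 1 : ℕ) : ℝ) / m - w), F α =
      ∫ β in (0 : ℝ)..w, (F (j / m + β) + F (j / m - β)) := by
    intro j
    have hadd : Continuous fun β : ℝ => F (j / m + β) := by fun_prop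
    have hsub : Continuous fun β : ℝ => F (j / m - β) := by fun_prop
    rw [intervalIntegral.integral_add (hadd.intervalIntegrable _ _) (hsub.intervalIntegrable _ _),
      intervalIntegral.integral_comp_add_left, intervalIntegral.integral_comp_sub_left, add_zero,
      sub_zero, add_comm (∫ x in ((j : ℝ) / m)..(j / m + w), F x),
      intervalIntegral.integral_add_adjacent_intervals
        (hF.intervalIntegrable _ _) (hF.intervalIntegrable _ _)]
    congr 1
    rw [hw]
    push_cast
    field_simp
    ring
  rw [h1]
  refine (norm_sum_le _ _).trans ?_
  refine (Finset.sum_le_card_nsmul _ _ (∫ β in (0 : ℝ)..w, b β) fun j hj => ?_).trans ?_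
  · rw [h2]
    refine (intervalIntegral.norm_integral_le_integral_norm hw0).trans ?_
    refine intervalIntegral.integral_mono_on hw0 ?_ (hb.intervalIntegrable _ _) ?_
    · exact (Continuous.intervalIntegrable (by fun_prop) _ _)
    · exact fun β hβ => h j (Finset.mem_range.1 hj) β hβ.1 hβ.2
  · simp

/-! ### Products of kernels along the orbit of multiplication by `g` -/

lemma le_abs_centred_orbit {g : ℕ} (hg : 2 ≤ g) {y : ℝ} (hy : |centred y| ≤ 1 / (8 * g)) :
    2 * |centred y| ≤ |centred (g * y)| := by
  have hg2 : (2 : ℝ) ≤ g := by exact_mod_cast hg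
  have h1 : |g * centred y| ≤ 1 / 2 := by
    rw [abs_mul, Nat.abs_cast]
    calc (g : ℝ) * |centred y| ≤ g * (1 / (8 * g)) := by gcongr
      _ ≤ 1 / 2 := by field_simp; norm_num
  have h2 : |centred (g * centred y)| ≤ |centred (g * y)| := by
    have := abs_centred_le (g * centred y) (round (g * y) - g * round y)
    refine this.trans (le_of_eq ?_)
    unfold centred
    push_cast
    congr 1
    ring
  rw [abs_centred_of_abs_le_half h1, abs_mul, Nat.abs_cast] at h2
  nlinarith [abs_nonneg (centred y)]

/-- Indices at which the orbit of `θ` under multiplication by `g` is close to an integer. -/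
def nearIndices (g K : ℕ) (θ : ℝ) : Finset ℕ :=
  (Finset.range K).filter fun i => |centred ((g : ℝ) ^ i * θ)| ≤ 1 / (8 * g)

/-- Indices at which the orbit of `θ` under multiplication by `g` is far from the integers. -/
def farIndices (g K : ℕ) (θ : ℝ) : Finset ℕ :=
  (Finset.range K).filter fun i => ¬ |centred ((g : ℝ) ^ i * θ)| ≤ 1 / (8 * g)

lemma card_nearIndices_add_card_farIndices (g K : ℕ) (θ : ℝ) :
    (nearIndices g K θ).card + (farIndices g K θ).card = K := by
  rw [nearIndices, farIndices, Finset.card_filter_add_card_filter_not, Finset.card_range]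

lemma sum_nearIndices_le {g : ℕ} (hg : 2 ≤ g) (K : ℕ) (θ : ℝ) :
    ∑ i ∈ nearIndices g K θ, |centred ((g : ℝ) ^ i * θ)| ≤ (farIndices g K θ).card + 1 := by
  have h : ∀ K : ℕ, ∑ i ∈ nearIndices g K θ, |centred ((g : ℝ) ^ i * θ)| ≤
      (farIndices g K θ).card + |centred ((g : ℝ) ^ K * θ)| := by
    intro K
    induction K with
    | zero => simp [nearIndices, farIndices]
    | succ K ih =>
      have h1 := abs_nonneg (centred ((g : ℝ) ^ (K + 1) * θ))
      have h2 := abs_centred_le_half ((g : ℝ) ^ K * θ)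
      by_cases hK : |centred ((g : ℝ) ^ K * θ)| ≤ 1 / (8 * g)
      · have h3 := le_abs_centred_orbit hg hK
        rw [← mul_assoc, ← pow_succ'] at h3
        have hn : nearIndices g (K + 1) θ = insert K (nearIndices g K θ) := by
          rw [nearIndices, Finset.range_add_one, Finset.filter_insert, if_pos hK, nearIndices]
        have hf : farIndices g (K + 1) θ = farIndices g K θ := by
          rw [farIndices, Finset.range_add_one, Finset.filter_insert, if_neg (not_not.2 hK),
            farIndices]
        rw [hn, hf, Finset.sum_insert (by simp [nearIndices])]
        linarith
      · have hn : nearIndices g (K + 1) θ = nearIndices g K θ := by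
          rw [nearIndices, Finset.range_add_one, Finset.filter_insert, if_neg hK, nearIndices]
        have hf : farIndices g (K + 1) θ = insert K (farIndices g K θ) := by
          rw [farIndices, Finset.range_add_one, Finset.filter_insert, if_pos hK, farIndices]
        rw [hn, hf, Finset.card_insert_of_notMem (by simp [farIndices])]
        push_cast
        linarith
  have := h K
  have := abs_centred_le_half ((g : ℝ) ^ K * θ)
  linarith

/-- The normalised product of real kernels along the orbit of `θ`, translated by `β`. -/
def orbitProduct (g K : ℕ) (θ β : ℝ) : ℝ :=
  ∏ i ∈ Finset.range K, realKernel g (β + centred ((g : ℝ) ^ i * θ))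

lemma digitKernel_add_centred (g : ℕ) (β y : ℝ) :
    digitKernel g (β + centred y) = digitKernel g (β + y) := by
  rw [← digitKernel_add_intCast g (β + centred y) (round y)]
  unfold centred
  congr 1
  ring

lemma pow_mul_abs_orbitProduct {g : ℕ} (hg : 0 < g) (K : ℕ) (θ β : ℝ) :
    (g : ℝ) ^ K * |orbitProduct g K θ β| =
      ‖∏ i ∈ Finset.range K, digitKernel g (β + (g : ℝ) ^ i * θ)‖ := by
  rw [norm_prod, orbitProduct, Finset.abs_prod]
  have h : ∀ i : ℕ, ‖digitKernel g (β + (g : ℝ) ^ i * θ)‖ =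
      g * |realKernel g (β + centred ((g : ℝ) ^ i * θ))| := by
    intro i
    rw [← digitKernel_add_centred, norm_digitKernel hg]
  rw [Finset.prod_congr rfl fun i _ => h i, Finset.prod_mul_distrib, Finset.prod_const,
    Finset.card_range]

lemma prod_digitKernel_eq {g : ℕ} (hg : 0 < g) (K : ℕ) (θ β : ℝ) :
    ∏ i ∈ Finset.range K, digitKernel g (β + (g : ℝ) ^ i * θ) =
      eC (∑ i ∈ Finset.range K, ((g : ℝ) - 1) / 2 * centred ((g : ℝ) ^ i * θ)) *
        (eC (muK g K * β) * ((g : ℝ) ^ K * orbitProduct g K θ β : ℝ)) := by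
  have h : ∀ i : ℕ, digitKernel g (β + (g : ℝ) ^ i * θ) =
      eC (((g : ℝ) - 1) / 2 * β) * eC (((g : ℝ) - 1) / 2 * centred ((g : ℝ) ^ i * θ)) *
        (g * (realKernel g (β + centred ((g : ℝ) ^ i * θ)) : ℂ)) := by
    intro i
    rw [← digitKernel_add_centred, digitKernel_eq hg, mul_add, eC_add]
    push_cast
    ring
  rw [Finset.prod_congr rfl fun i _ => h i, Finset.prod_mul_distrib, Finset.prod_mul_distrib,
    Finset.prod_mul_distrib, eC_sum, ← eC_sum _ fun _ => ((g : ℝ) - 1) / 2 * β, orbitProduct]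
  have h2 : ∑ i ∈ Finset.range K, ((g : ℝ) - 1) / 2 * β = muK g K * β := by
    rw [Finset.sum_const, Finset.card_range, muK, nsmul_eq_mul]
    ring
  rw [h2]
  push_cast
  simp only [Finset.prod_const, Finset.card_range]
  ring

lemma norm_sum_eC_mul_le (N : ℕ) {θ η : ℝ} (hη : 0 < η) (h : η ≤ |centred θ|) :
    ‖∑ n ∈ Finset.range N, eC (n * θ)‖ ≤ 1 / (2 * η) := by
  have h1 : 4 * η ≤ ‖eC θ - 1‖ := by
    rw [norm_eC_sub_one]
    linarith [two_mul_abs_centred_le_abs_sin θ]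
  have h2 : ∀ n : ℕ, eC (n * θ) = eC θ ^ n := by
    intro n
    unfold eC
    rw [← Complex.exp_nat_mul]
    push_cast
    ring_nf
  have h3 : eC θ ≠ 1 := by
    intro h0
    rw [h0, sub_self, norm_zero] at h1
    linarith
  rw [Finset.sum_congr rfl fun n _ => h2 n, geom_sum_eq h3, norm_div]
  have h4 : ‖eC θ ^ N - 1‖ ≤ 2 := by
    refine (norm_sub_le _ _).trans ?_
    rw [norm_pow, norm_eC, one_pow, norm_one]
    norm_num
  calc ‖eC θ ^ N - 1‖ / ‖eC θ - 1‖ ≤ 2 / (4 * η) := by gcongr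
    _ = 1 / (2 * η) := by field_simp; norm_num

lemma abs_orbitProduct_zero_le {g : ℕ} (hg : 2 ≤ g) (K : ℕ) {θ η : ℝ} (hη : 0 < η)
    (h : η ≤ |centred θ|) : (g : ℝ) ^ K * |orbitProduct g K θ 0| ≤ 1 / (2 * η) := by
  rw [pow_mul_abs_orbitProduct (by omega), ← sum_eC_digitSum_mul_add hg]
  simpa using norm_sum_eC_mul_le (g ^ K) hη h

lemma abs_orbitProduct_le_exp {g : ℕ} (hg : 2 ≤ g) (K : ℕ) (θ β : ℝ) :
    |orbitProduct g K θ β| ≤ Real.exp (-(4 / g *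
      ∑ i ∈ Finset.range K, centred (β + centred ((g : ℝ) ^ i * θ)) ^ 2)) := by
  rw [orbitProduct, Finset.abs_prod, Finset.mul_sum, ← Finset.sum_neg_distrib, Real.exp_sum]
  exact Finset.prod_le_prod (fun _ _ => abs_nonneg _) fun _ _ => abs_realKernel_le hg _

/-- If `β` is far from every fixed point of multiplication by `g`, the product is exponentially
small. -/
lemma abs_orbitProduct_le_of_le_abs {g : ℕ} (hg : 2 ≤ g) (K : ℕ) (θ : ℝ) {β δ : ℝ} (hδ : 0 ≤ δ)
    (hβ : δ ≤ |β|) (hβ' : ((g : ℝ) - 1) * |β| ≤ 1 / 2) :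
    |orbitProduct g (K + 1) θ β| ≤ Real.exp (-(δ ^ 2 / g ^ 3 * K)) := by
  have hg2 : (2 : ℝ) ≤ g := by exact_mod_cast hg
  set x : ℕ → ℝ := fun i => |centred (β + centred ((g : ℝ) ^ i * θ))| with hx
  have h1 : ∀ i, δ ≤ x (i + 1) + g * x i := by
    intro i
    have h2 : |centred (-((g : ℝ) - 1) * β)| = ((g : ℝ) - 1) * |β| := by
      rw [abs_centred_of_abs_le_half] <;>
        rw [abs_mul, abs_neg, abs_of_nonneg (by linarith : (0 : ℝ) ≤ g - 1)]
      exact hβ'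
    set a := β + centred ((g : ℝ) ^ i * θ) with ha
    set b := β + centred ((g : ℝ) ^ (i + 1) * θ) with hb
    have h3 := abs_centred_le (-((g : ℝ) - 1) * β) (round ((g : ℝ) ^ (i + 1) * θ) -
      g * round ((g : ℝ) ^ i * θ) + round b - g * round a)
    have h4 : -((g : ℝ) - 1) * β - ((round ((g : ℝ) ^ (i + 1) * θ) -
        g * round ((g : ℝ) ^ i * θ) + round b - g * round a : ℤ) : ℝ) =
        centred b - g * centred a := by
      have h5 : centred b = b - round b := rfl
      have h6 : centred a = a - round a := rfl
      rw [h5, h6, hb, ha]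
      unfold centred
      push_cast
      ring
    rw [h4, h2] at h3
    have h7 := abs_sub (centred b) (g * centred a)
    rw [abs_mul, Nat.abs_cast] at h7
    have h8 : |β| ≤ ((g : ℝ) - 1) * |β| := by nlinarith [abs_nonneg β]
    simp only [hx, ← ha, ← hb]
    linarith
  have h2 : ∀ i, δ ^ 2 / (2 * g ^ 2) ≤ x i ^ 2 + x (i + 1) ^ 2 := by
    intro i
    rw [div_le_iff₀ (by positivity)]
    have hg4 : (1 : ℝ) ≤ g ^ 2 := by nlinarith
    have h3 : δ ^ 2 ≤ (x (i + 1) + g * x i) ^ 2 := by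
      have := h1 i
      gcongr
    nlinarith [sq_nonneg (x (i + 1) - g * x i), sq_nonneg (x (i + 1)),
      mul_nonneg (sub_nonneg.2 hg4) (sq_nonneg (x (i + 1)))]
  have h3 : K * (δ ^ 2 / (2 * g ^ 2)) ≤ 2 * ∑ i ∈ Finset.range (K + 1), x i ^ 2 := by
    have h4 : K * (δ ^ 2 / (2 * g ^ 2)) ≤
        ∑ i ∈ Finset.range K, (x i ^ 2 + x (i + 1) ^ 2) := by
      simpa using Finset.card_nsmul_le_sum (Finset.range K) _ _ fun i _ => h2 i
    rw [Finset.sum_add_distrib] at h4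
    have h5 := Finset.sum_range_succ (fun i => x i ^ 2) K
    have h6 := Finset.sum_range_succ' (fun i => x i ^ 2) K
    nlinarith [sq_nonneg (x K), sq_nonneg (x 0)]
  refine (abs_orbitProduct_le_exp hg (K + 1) θ β).trans (Real.exp_le_exp.2 (neg_le_neg ?_))
  simp only [hx, sq_abs] at h3
  calc δ ^ 2 / g ^ 3 * K = 4 / g * (1 / 2 * (K * (δ ^ 2 / (2 * g ^ 2)))) := by
        field_simp
        norm_num
    _ ≤ _ := by
        gcongr
        linarith

/-! ### The symmetrised product near the origin -/

lemma abs_prod_le_one {ι : Type*} (s : Finset ι) {f : ι → ℝ} (h : ∀ i ∈ s, |f i| ≤ 1) :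
    |∏ i ∈ s, f i| ≤ 1 := by
  rw [Finset.abs_prod]
  exact Finset.prod_le_one (fun _ _ => abs_nonneg _) h

lemma abs_prod_sub_prod_le {ι : Type*} (s : Finset ι) {f f₀ : ι → ℝ} {t : ℝ}
    (hf : ∀ i ∈ s, |f i| ≤ 1) (hf₀ : ∀ i ∈ s, |f₀ i| ≤ 1) (h : ∀ i ∈ s, |f i - f₀ i| ≤ t) :
    |∏ i ∈ s, f i - ∏ i ∈ s, f₀ i| ≤ s.card * t := by
  classical
  induction s using Finset.induction_on with
  | empty => simp
  | insert a s ha ih =>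
    simp only [Finset.mem_insert, forall_eq_or_imp] at hf hf₀ h
    rw [Finset.prod_insert ha, Finset.prod_insert ha, Finset.card_insert_of_notMem ha]
    have h1 := abs_prod_le_one s hf.2
    have h2 := ih hf.2 hf₀.2 h.2
    have h3 : f a * ∏ i ∈ s, f i - f₀ a * ∏ i ∈ s, f₀ i =
        (f a - f₀ a) * ∏ i ∈ s, f i + f₀ a * (∏ i ∈ s, f i - ∏ i ∈ s, f₀ i) := by ring
    have ht : 0 ≤ t := (abs_nonneg _).trans h.1
    rw [h3]
    refine (abs_add_le _ _).trans ?_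
    rw [abs_mul, abs_mul]
    calc _ ≤ t * 1 + 1 * (s.card * t) := by
          gcongr
          exacts [h.1, hf₀.1]
      _ = _ := by push_cast; ring

lemma abs_prod_second_difference_le {ι : Type*} (s : Finset ι) {f₁ f₂ f₀ : ι → ℝ} {t : ℝ}
    (hf₁ : ∀ i ∈ s, |f₁ i| ≤ 1) (hf₂ : ∀ i ∈ s, |f₂ i| ≤ 1) (hf₀ : ∀ i ∈ s, |f₀ i| ≤ 1)
    (h₁ : ∀ i ∈ s, |f₁ i - f₀ i| ≤ t) (h₂ : ∀ i ∈ s, |f₂ i - f₀ i| ≤ t)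
    (h : ∀ i ∈ s, |f₁ i + f₂ i - 2 * f₀ i| ≤ t ^ 2) :
    |∏ i ∈ s, f₁ i + ∏ i ∈ s, f₂ i - 2 * ∏ i ∈ s, f₀ i| ≤ (s.card * t) ^ 2 := by
  classical
  induction s using Finset.induction_on with
  | empty => norm_num
  | insert a s ha ih =>
    simp only [Finset.mem_insert, forall_eq_or_imp] at hf₁ hf₂ hf₀ h₁ h₂ h
    rw [Finset.prod_insert ha, Finset.prod_insert ha, Finset.prod_insert ha,
      Finset.card_insert_of_notMem ha]
    have b₀ := abs_prod_le_one s hf₀.2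
    have d₁ := abs_prod_sub_prod_le s hf₁.2 hf₀.2 h₁.2
    have d₂ := abs_prod_sub_prod_le s hf₂.2 hf₀.2 h₂.2
    have d := ih hf₁.2 hf₂.2 hf₀.2 h₁.2 h₂.2 h.2
    have ht : 0 ≤ t := (abs_nonneg _).trans h₁.1
    set P₁ := ∏ i ∈ s, f₁ i
    set P₂ := ∏ i ∈ s, f₂ i
    set P₀ := ∏ i ∈ s, f₀ i
    have e : f₁ a * P₁ + f₂ a * P₂ - 2 * (f₀ a * P₀) =
        f₀ a * (P₁ + P₂ - 2 * P₀) + (f₁ a - f₀ a) * (P₁ - P₀) + (f₂ a - f₀ a) * (P₂ - P₀) +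
          (f₁ a + f₂ a - 2 * f₀ a) * P₀ := by ring
    rw [e]
    refine (abs_add_le _ _).trans ?_
    refine (add_le_add_left (abs_add_le _ _) _).trans ?_
    refine (add_le_add_left (add_le_add_left (abs_add_le _ _) _) _).trans ?_
    simp only [abs_mul]
    calc _ ≤ 1 * (s.card * t) ^ 2 + t * (s.card * t) + t * (s.card * t) + t ^ 2 * 1 := by
          gcongr
          exacts [hf₀.1, h₁.1, h₂.1, h.1]
      _ = _ := by push_cast; ring

lemma exp_sub_one_le_mul_exp (x : ℝ) : Real.exp x - 1 ≤ x * Real.exp x := by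
  have h := Real.add_one_le_exp (-x)
  have h2 : Real.exp (-x) * Real.exp x = 1 := by rw [← Real.exp_add]; simp
  nlinarith [Real.exp_pos x]

lemma norm_symmetrised_le {T₁ T₂ T₀ x : ℝ} {z₁ z₂ : ℂ} (hx : 0 ≤ x) (h₁ : |T₁ - T₀| ≤ x)
    (h₂ : |T₂ - T₀| ≤ x) (h : |T₁ + T₂ - 2 * T₀| ≤ x ^ 2) (hz₁ : ‖z₁ - 1‖ ≤ Real.exp x - 1)
    (hz₂ : ‖z₂ - 1‖ ≤ Real.exp x - 1) :
    ‖T₁ * z₁ + T₂ * z₂‖ ≤ (3 * x ^ 2 + 2 * |T₀|) * Real.exp x := by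
  have e : (T₁ * z₁ + T₂ * z₂ : ℂ) = ((T₁ - T₀ : ℝ) : ℂ) * (z₁ - 1) +
      ((T₂ - T₀ : ℝ) : ℂ) * (z₂ - 1) + ((T₁ + T₂ - 2 * T₀ : ℝ) : ℂ) + (T₀ : ℂ) * (z₁ + z₂) := by
    push_cast
    ring
  have hz : ∀ z : ℂ, ‖z - 1‖ ≤ Real.exp x - 1 → ‖z‖ ≤ Real.exp x := by
    intro z hz
    have := norm_sub_norm_le z 1
    rw [norm_one] at this
    linarith
  have hs : ‖z₁ + z₂‖ ≤ 2 * Real.exp x := by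
    have := norm_add_le z₁ z₂
    linarith [hz _ hz₁, hz _ hz₂]
  rw [e]
  refine (norm_add_le _ _).trans ((add_le_add_left norm_add₃_le _).trans ?_)
  simp only [norm_mul, Complex.norm_real, Real.norm_eq_abs]
  have he := exp_sub_one_le_mul_exp x
  have he1 : 1 ≤ Real.exp x := Real.one_le_exp hx
  calc _ ≤ x * (x * Real.exp x) + x * (x * Real.exp x) + x ^ 2 * Real.exp x +
        |T₀| * (2 * Real.exp x) := by
        gcongr
        · exact hz₁.trans he
        · exact hz₂.trans he
        · exact h.trans (le_mul_of_one_le_right (sq_nonneg x) he1)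
    _ = _ := by ring

/-- The product over the near indices is, up to a factor close to `1`, an even function of `β`. -/
lemma exists_prod_nearIndices_eq {g : ℕ} (hg : 2 ≤ g) (K : ℕ) (θ κ : ℝ) {β : ℝ}
    (hβ : |β| ≤ 1 / (8 * g)) :
    ∃ z : ℂ, eC (κ * β) *
        ((∏ i ∈ nearIndices g K θ, realKernel g (β + centred ((g : ℝ) ^ i * θ)) : ℝ) : ℂ) =
        ((∏ i ∈ nearIndices g K θ, realKernel g (centred ((g : ℝ) ^ i * θ))) *
          realKernel g β ^ (nearIndices g K θ).card : ℝ) * z ∧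
      ‖z - 1‖ ≤ Real.exp ((12 * (Real.pi * g) ^ 2 * ((farIndices g K θ).card + 1) +
        2 * Real.pi * |κ|) * |β|) - 1 := by
  have hg0 : 0 < g := by omega
  set y : ℕ → ℝ := fun i => centred ((g : ℝ) ^ i * θ) with hy
  set A := nearIndices g K θ with hA
  have hyA : ∀ i ∈ A, |y i| ≤ 1 / (8 * g) := fun i hi => (Finset.mem_filter.1 hi).2
  have pβ := half_le_realKernel hg0 hβ
  set w : ℕ → ℝ := fun i => realKernel g (β + y i) / (realKernel g β * realKernel g (y i)) - 1
    with hw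
  have hwb : ∀ i ∈ A, |w i| ≤ 12 * (Real.pi * g) ^ 2 * |β| * |y i| := by
    intro i hi
    have py := half_le_realKernel hg0 (hyA i hi)
    have pp : 1 / 4 ≤ realKernel g β * realKernel g (y i) := by nlinarith
    have e : w i = (realKernel g (β + y i) - realKernel g β * realKernel g (y i)) /
        (realKernel g β * realKernel g (y i)) := by
      rw [hw, sub_div, div_self (by positivity)]
    rw [e, abs_div, abs_of_pos (by linarith : 0 < realKernel g β * realKernel g (y i)),
      div_le_iff₀ (by linarith)]
    refine (abs_realKernel_add_sub_mul_le hg0 β (y i)).trans ?_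
    calc _ = 12 * (Real.pi * g) ^ 2 * |β| * |y i| * (1 / 4) := by ring
      _ ≤ _ := by gcongr
  have hprod : ∏ i ∈ A, realKernel g (β + y i) =
      (∏ i ∈ A, realKernel g (y i)) * realKernel g β ^ A.card * ∏ i ∈ A, (1 + w i) := by
    rw [← Finset.prod_const, ← Finset.prod_mul_distrib, ← Finset.prod_mul_distrib]
    refine Finset.prod_congr rfl fun i hi => ?_
    have py := half_le_realKernel hg0 (hyA i hi)
    have h1 : realKernel g β ≠ 0 := by linarith
    have h2 : realKernel g (y i) ≠ 0 := by linarith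
    simp only [hw]
    field_simp
    ring
  have hV : |∏ i ∈ A, (1 + w i) - 1| ≤
      Real.exp (12 * (Real.pi * g) ^ 2 * ((farIndices g K θ).card + 1) * |β|) - 1 := by
    refine (Finset.norm_prod_one_add_sub_one_le A w).trans ?_
    gcongr
    calc ∑ i ∈ A, ‖w i‖ ≤ ∑ i ∈ A, 12 * (Real.pi * g) ^ 2 * |β| * |y i| :=
          Finset.sum_le_sum hwb
      _ = 12 * (Real.pi * g) ^ 2 * |β| * ∑ i ∈ A, |y i| := by rw [Finset.mul_sum]
      _ ≤ 12 * (Real.pi * g) ^ 2 * |β| * ((farIndices g K θ).card + 1) := by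
          gcongr
          exact sum_nearIndices_le hg K θ
      _ = _ := by ring
  refine ⟨eC (κ * β) * (∏ i ∈ A, (1 + w i) : ℝ), ?_, ?_⟩
  · rw [hprod]
    push_cast
    ring
  · have e : eC (κ * β) * ((∏ i ∈ A, (1 + w i) : ℝ) : ℂ) - 1 =
        eC (κ * β) * ((∏ i ∈ A, (1 + w i) - 1 : ℝ) : ℂ) + (eC (κ * β) - 1) := by
      push_cast
      ring
    rw [e]
    refine (norm_add_le _ _).trans ?_
    rw [norm_mul, norm_eC, one_mul, Complex.norm_real, Real.norm_eq_abs, add_mul, Real.exp_add]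
    have h1 := norm_eC_sub_one_le (κ * β)
    rw [abs_mul] at h1
    have h2 := Real.add_one_le_exp (2 * Real.pi * |κ| * |β|)
    have h3 : 1 ≤ Real.exp (12 * (Real.pi * g) ^ 2 * ((farIndices g K θ).card + 1) * |β|) :=
      Real.one_le_exp (by positivity)
    have h4 : 0 ≤ 2 * Real.pi * |κ| * |β| := by positivity
    nlinarith

lemma orbitProduct_eq_mul (g K : ℕ) (θ β : ℝ) :
    orbitProduct g K θ β =
      (∏ i ∈ nearIndices g K θ, realKernel g (β + centred ((g : ℝ) ^ i * θ))) *
        ∏ i ∈ farIndices g K θ, realKernel g (β + centred ((g : ℝ) ^ i * θ)) :=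
  (Finset.prod_filter_mul_prod_filter_not _ _ _).symm

lemma norm_symmetrised_orbitProduct_le {g : ℕ} (hg : 2 ≤ g) (K : ℕ) (θ κ : ℝ) {β M : ℝ}
    (hβ0 : 0 ≤ β) (hβ : β ≤ 1 / (8 * g))
    (hM : 12 * (Real.pi * g) ^ 2 * ((farIndices g K θ).card + 1) + 2 * Real.pi * |κ| ≤ M) :
    ‖eC (κ * β) * orbitProduct g K θ β + eC (κ * -β) * orbitProduct g K θ (-β)‖ ≤
      Real.exp (-(4 / g * β ^ 2 * (nearIndices g K θ).card)) *
        ((3 * (M * β) ^ 2 + 2 * |orbitProduct g K θ 0|) * Real.exp (M * β)) := by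
  have hg0 : 0 < g := by omega
  have hg1 : (1 : ℝ) ≤ g := by exact_mod_cast hg0
  have hβa : |β| = β := abs_of_nonneg hβ0
  have hβ2 : |β| ≤ 1 / 2 := by
    rw [hβa]
    refine hβ.trans ?_
    gcongr
    linarith
  obtain ⟨z₁, e₁, hz₁⟩ := exists_prod_nearIndices_eq hg K θ κ (β := β) (by rwa [hβa])
  obtain ⟨z₂, e₂, hz₂⟩ := exists_prod_nearIndices_eq hg K θ κ (β := -β) (by rwa [abs_neg, hβa])
  set L := (farIndices g K θ).card with hL
  have hexp : Real.exp ((12 * (Real.pi * g) ^ 2 * (L + 1) + 2 * Real.pi * |κ|) * β) - 1 ≤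
      Real.exp (M * β) - 1 := by gcongr
  rw [hβa] at hz₁
  rw [abs_neg, hβa] at hz₂
  rw [realKernel_neg] at e₂
  set y : ℕ → ℝ := fun i => centred ((g : ℝ) ^ i * θ) with hy
  set A := nearIndices g K θ with hA
  set B := farIndices g K θ with hB
  have hx : L * (Real.pi * g * |β|) ≤ M * β := by
    rw [hβa, ← mul_assoc]
    gcongr
    refine le_trans ?_ hM
    have h1 : 1 ≤ Real.pi * g := by nlinarith [Real.pi_gt_three]
    have h2 : (0 : ℝ) ≤ L := by positivity
    have h3 : 0 ≤ 2 * Real.pi * |κ| := by positivity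
    have h4 : Real.pi * g ≤ (Real.pi * g) ^ 2 := by nlinarith
    nlinarith [mul_le_mul_of_nonneg_left h4 h2, sq_nonneg (Real.pi * g)]
  have hx0 : 0 ≤ L * (Real.pi * g * |β|) := by positivity
  have hsum := norm_symmetrised_le (T₁ := ∏ i ∈ B, realKernel g (β + y i))
    (T₂ := ∏ i ∈ B, realKernel g (-β + y i)) (T₀ := ∏ i ∈ B, realKernel g (0 + y i))
    (x := M * β) (z₁ := z₁) (z₂ := z₂) (hx0.trans hx)
    (le_trans (abs_prod_sub_prod_le B (fun _ _ => abs_realKernel_le_one hg _)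
      (fun _ _ => abs_realKernel_le_one hg _) fun i _ => by
        rw [zero_add, add_comm]
        exact abs_realKernel_add_sub_le hg0 _ _) hx)
    (le_trans (abs_prod_sub_prod_le B (fun _ _ => abs_realKernel_le_one hg _)
      (fun _ _ => abs_realKernel_le_one hg _) fun i _ => by
        rw [zero_add, add_comm, ← abs_neg β]
        exact abs_realKernel_add_sub_le hg0 _ _) hx)
    (le_trans (abs_prod_second_difference_le B (fun _ _ => abs_realKernel_le_one hg _)
      (fun _ _ => abs_realKernel_le_one hg _) (fun _ _ => abs_realKernel_le_one hg _)
      (t := Real.pi * g * |β|)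
      (fun i _ => by
        rw [zero_add, add_comm]
        exact abs_realKernel_add_sub_le hg0 _ _)
      (fun i _ => by
        rw [zero_add, add_comm, ← abs_neg β]
        exact abs_realKernel_add_sub_le hg0 _ _)
      fun i _ => by
        rw [zero_add, add_comm β, neg_add_eq_sub]
        exact abs_realKernel_second_difference_le hg0 _ _) (by gcongr))
    (hz₁.trans hexp) (hz₂.trans hexp)
  set S₀ := ∏ i ∈ A, realKernel g (y i) with hS₀
  have hS₀0 : 0 ≤ S₀ := Finset.prod_nonneg fun i hi => by
    have := half_le_realKernel hg0 (Finset.mem_filter.1 hi).2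
    simp only [hy]
    linarith
  have hS₀1 : S₀ ≤ 1 := (le_abs_self _).trans
    (abs_prod_le_one A fun _ _ => abs_realKernel_le_one hg _)
  have hR : |orbitProduct g K θ 0| = S₀ * |∏ i ∈ B, realKernel g (0 + y i)| := by
    rw [orbitProduct_eq_mul, abs_mul]
    simp only [zero_add, ← hA, ← hB]
    rw [← abs_of_nonneg hS₀0]
  have hG : |realKernel g β ^ A.card| ≤ Real.exp (-(4 / g * β ^ 2 * A.card)) := by
    rw [abs_pow]
    have h1 := abs_realKernel_le hg β
    rw [← sq_abs (centred β), abs_centred_of_abs_le_half hβ2, sq_abs] at h1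
    calc |realKernel g β| ^ A.card ≤ Real.exp (-(4 / g * β ^ 2)) ^ A.card := by gcongr
      _ = _ := by
        rw [← Real.exp_nat_mul]
        congr 1
        ring
  have hE : eC (κ * β) * orbitProduct g K θ β + eC (κ * -β) * orbitProduct g K θ (-β) =
      ((realKernel g β ^ A.card : ℝ) : ℂ) * ((S₀ : ℂ) *
        (((∏ i ∈ B, realKernel g (β + y i) : ℝ) : ℂ) * z₁ +
          ((∏ i ∈ B, realKernel g (-β + y i) : ℝ) : ℂ) * z₂)) := by
    rw [orbitProduct_eq_mul, orbitProduct_eq_mul, Complex.ofReal_mul, Complex.ofReal_mul,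
      ← mul_assoc, ← mul_assoc, e₁, e₂, Complex.ofReal_mul]
    ring
  rw [hE, norm_mul, norm_mul, Complex.norm_real, Complex.norm_real, Real.norm_eq_abs,
    Real.norm_eq_abs, abs_of_nonneg hS₀0]
  refine mul_le_mul hG ?_ (by positivity) (Real.exp_pos _).le
  calc _ ≤ S₀ * ((3 * (M * β) ^ 2 + 2 * |∏ i ∈ B, realKernel g (0 + y i)|) *
        Real.exp (M * β)) := by gcongr
    _ = (S₀ * (3 * (M * β) ^ 2) + 2 * |orbitProduct g K θ 0|) * Real.exp (M * β) := by
      rw [hR]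
      ring
    _ ≤ _ := by
      have : S₀ * (3 * (M * β) ^ 2) ≤ 3 * (M * β) ^ 2 :=
        mul_le_of_le_one_left (by positivity) hS₀1
      gcongr

/-! ### Bounding the symmetrised product and integrating -/

lemma exp_neg_mul_le {c u : ℝ} (hc : 0 < c) (hu : 0 < u) (n : ℕ) :
    Real.exp (-(c * u)) ≤ n.factorial / c ^ n * (u ^ n)⁻¹ := by
  have h := Real.pow_div_factorial_le_exp (c * u) (by positivity) n
  rw [Real.exp_neg]
  refine (inv_anti₀ (by positivity) h).trans (le_of_eq ?_)
  rw [mul_pow]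
  field_simp

lemma abs_orbitProduct_le_exp_card_farIndices {g : ℕ} (hg : 2 ≤ g) (K : ℕ) (θ : ℝ) {β : ℝ}
    (hβ : |β| ≤ 1 / (16 * g)) :
    |orbitProduct g K θ β| ≤ Real.exp (-(1 / (64 * g ^ 3) * (farIndices g K θ).card)) := by
  have hg0 : (0 : ℝ) < g := by positivity
  have h : ∀ i ∈ farIndices g K θ,
      (1 / (16 * g) : ℝ) ^ 2 ≤ centred (β + centred ((g : ℝ) ^ i * θ)) ^ 2 := by
    intro i hi
    have h1 : 1 / (8 * g) < |centred ((g : ℝ) ^ i * θ)| := not_le.1 (Finset.mem_filter.1 hi).2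
    set y := (g : ℝ) ^ i * θ
    have h2 := abs_centred_le y (round y + round (β + centred y))
    have h3 : y - (round y + round (β + centred y) : ℤ) = centred (β + centred y) - β := by
      unfold centred
      push_cast
      ring
    rw [h3] at h2
    have h4 := abs_sub (centred (β + centred y)) β
    have h5 : (1 / (8 * g) : ℝ) = 1 / (16 * g) + 1 / (16 * g) := by
      field_simp
      norm_num
    rw [← sq_abs (centred _)]
    gcongr
    linarith
  refine (abs_orbitProduct_le_exp hg K θ β).trans (Real.exp_le_exp.2 (neg_le_neg ?_))
  have h6 : (farIndices g K θ).card * (1 / (16 * g) : ℝ) ^ 2 ≤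
      ∑ i ∈ Finset.range K, centred (β + centred ((g : ℝ) ^ i * θ)) ^ 2 := by
    refine le_trans ?_ (Finset.sum_le_sum_of_subset_of_nonneg
      (Finset.filter_subset _ _ : farIndices g K θ ⊆ _) fun _ _ _ => sq_nonneg _)
    rw [← nsmul_eq_mul]
    exact Finset.card_nsmul_le_sum _ _ _ h
  calc _ = 4 / g * ((farIndices g K θ).card * (1 / (16 * g) : ℝ) ^ 2) := by
        field_simp
        ring
    _ ≤ _ := by gcongr

lemma half_le_card_nearIndices {g K : ℕ} {θ u : ℝ} (hK : 2 ≤ K) (huK : u ^ 8 = K)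
    (hLu : (farIndices g K θ).card ≤ u) : (K : ℝ) / 2 ≤ (nearIndices g K θ).card := by
  set L := (farIndices g K θ).card with hL
  have h1 : ((nearIndices g K θ).card : ℝ) + L = K := by
    exact_mod_cast card_nearIndices_add_card_farIndices g K θ
  have h2 : 2 * L ≤ K := by
    rcases Nat.lt_or_ge L 2 with h | h
    · omega
    · have h3 : L ^ 8 ≤ K := by
        have : (L : ℝ) ^ 8 ≤ K := huK ▸ pow_le_pow_left₀ (by positivity) hLu 8
        exact_mod_cast this
      calc 2 * L ≤ L ^ 2 := by nlinarith
        _ ≤ L ^ 8 := Nat.pow_le_pow_right (by omega) (by norm_num)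
        _ ≤ K := h3
  have h4 : 2 * (L : ℝ) ≤ K := by exact_mod_cast h2
  linarith

lemma mul_exp_neg_le_one (t : ℝ) : t * Real.exp (-t) ≤ 1 := by
  calc t * Real.exp (-t) ≤ Real.exp t * Real.exp (-t) := by
        gcongr
        linarith [Real.add_one_le_exp t]
    _ = 1 := by rw [← Real.exp_add, add_neg_cancel, Real.exp_zero]

lemma linear_sub_quadratic_le {g D u β a κ : ℝ} (hg : 0 < g) (hD : 0 ≤ D) (hu : 1 ≤ u)
    (hβ : 0 ≤ β) (huκ : u ^ 8 = κ) (ha : κ / 2 ≤ a) :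
    -(4 / g * β ^ 2 * a) + 2 * D * u * β ≤ 2 * (-(κ / (2 * g)) * β ^ 2) + g * D ^ 2 := by
  have h1 : 4 / g * β ^ 2 * (κ / 2) ≤ 4 / g * β ^ 2 * a := by gcongr
  have h2 : 2 * D * u * β ≤ 2 * D * u ^ 4 * β := by
    gcongr
    exact le_self_pow₀ hu (by norm_num)
  have h3 : κ / g * β ^ 2 + g * D ^ 2 - 2 * D * u ^ 4 * β = (u ^ 4 * β - g * D) ^ 2 / g := by
    rw [← huκ]
    field_simp
    ring
  have h4 : 0 ≤ (u ^ 4 * β - g * D) ^ 2 / g := by positivity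
  have h5 : 4 / g * β ^ 2 * (κ / 2) = 2 * (κ / g * β ^ 2) := by ring
  have h6 : 2 * (-(κ / (2 * g)) * β ^ 2) = -(κ / g * β ^ 2) := by
    field_simp
  linarith

lemma abs_orbitProduct_zero_le_inv_pow {g : ℕ} (hg : 2 ≤ g) {K : ℕ} {u : ℝ} (hu : 0 < u) {θ : ℝ}
    (hθ : u ^ 6 * ((g : ℝ) ^ K)⁻¹ / (g - 1) ≤ |centred θ|) :
    |orbitProduct g K θ 0| ≤ g / 2 * (u ^ 6)⁻¹ := by
  have hg2 : (2 : ℝ) ≤ g := by exact_mod_cast hg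
  have hg1 : (0 : ℝ) < g - 1 := by linarith
  have h1 := abs_orbitProduct_zero_le hg K (by positivity) hθ
  have h2 : 1 / (2 * (u ^ 6 * ((g : ℝ) ^ K)⁻¹ / (g - 1))) =
      (g : ℝ) ^ K * ((g - 1) / 2 * (u ^ 6)⁻¹) := by
    field_simp
  rw [h2] at h1
  refine (le_of_mul_le_mul_left h1 (by positivity)).trans ?_
  gcongr
  linarith

lemma norm_symmetrised_orbitProduct_le_gaussian {g : ℕ} (hg : 2 ≤ g) {C D : ℝ} (hC : 0 ≤ C)
    (hD : D = 12 * (Real.pi * g) ^ 2 + 2 * Real.pi * C) {K : ℕ} (hK : 2 ≤ K) {u : ℝ} (hu : 1 ≤ u)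
    (huK : u ^ 8 = K) {κ : ℝ} (hκ : |κ| ≤ C) {θ : ℝ}
    (hθ : u ^ 6 * ((g : ℝ) ^ K)⁻¹ / (g - 1) ≤ |centred θ|) (hL : (farIndices g K θ).card ≤ u)
    {β : ℝ} (hβ0 : 0 ≤ β) (hβ : β ≤ 1 / (16 * g)) :
    ‖eC (κ * β) * orbitProduct g K θ β + eC (κ * -β) * orbitProduct g K θ (-β)‖ ≤
      Real.exp (g * D ^ 2) * (24 * g * D ^ 2 + g) *
        ((u ^ 6)⁻¹ * Real.exp (-(K / (2 * g)) * β ^ 2)) := by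
  have hg0 : (0 : ℝ) < g := by positivity
  have hu0 : 0 < u := by linarith
  have hD0 : 0 ≤ D := by rw [hD]; positivity
  have hM : 12 * (Real.pi * g) ^ 2 * ((farIndices g K θ).card + 1) + 2 * Real.pi * |κ| ≤
      2 * D * u := by
    have h1 : C ≤ C * (2 * u) := le_mul_of_one_le_right hC (by linarith)
    calc _ ≤ 12 * (Real.pi * g) ^ 2 * (u + u) + 2 * Real.pi * (C * (2 * u)) := by
          gcongr
          exact hκ.trans h1
      _ = _ := by rw [hD]; ring
  have hR := abs_orbitProduct_zero_le_inv_pow hg hu0 hθ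
  have hmain := norm_symmetrised_orbitProduct_le hg K θ κ hβ0
    (hβ.trans (by gcongr; norm_num)) hM
  set X : ℝ := Real.exp (-(K / (2 * g)) * β ^ 2) with hX
  have hX0 : 0 < X := Real.exp_pos _
  have hexp : Real.exp (-(4 / g * β ^ 2 * (nearIndices g K θ).card)) *
      Real.exp (2 * D * u * β) ≤ X ^ 2 * Real.exp (g * D ^ 2) := by
    rw [← Real.exp_add, hX, ← Real.exp_nat_mul, ← Real.exp_add, Real.exp_le_exp]
    exact_mod_cast linear_sub_quadratic_le hg0 hD0 hu hβ0 huK (half_le_card_nearIndices hK huK hL)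
  have hXβ : X * (u * β) ^ 2 ≤ 2 * g * (u ^ 6)⁻¹ := by
    have h1 := mul_exp_neg_le_one (K / (2 * g) * β ^ 2)
    rw [← neg_mul, ← hX] at h1
    calc X * (u * β) ^ 2 = 2 * g * (u ^ 6)⁻¹ * (u ^ 8 / (2 * g) * β ^ 2 * X) := by
          field_simp
      _ ≤ 2 * g * (u ^ 6)⁻¹ * 1 := by
          rw [huK]
          gcongr
      _ = _ := mul_one _
  have hX1 : X ≤ 1 := by
    rw [hX, Real.exp_le_one_iff, neg_mul, neg_nonpos]
    positivity
  calc _ ≤ _ := hmain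
    _ = (Real.exp (-(4 / g * β ^ 2 * (nearIndices g K θ).card)) * Real.exp (2 * D * u * β)) *
        (12 * D ^ 2 * (u * β) ^ 2 + 2 * |orbitProduct g K θ 0|) := by ring
    _ ≤ (X ^ 2 * Real.exp (g * D ^ 2)) *
        (12 * D ^ 2 * (u * β) ^ 2 + 2 * (g / 2 * (u ^ 6)⁻¹)) := by gcongr
    _ = X * Real.exp (g * D ^ 2) *
        (12 * D ^ 2 * (X * (u * β) ^ 2) + X * (g * (u ^ 6)⁻¹)) := by ring
    _ ≤ X * Real.exp (g * D ^ 2) *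
        (12 * D ^ 2 * (2 * g * (u ^ 6)⁻¹) + 1 * (g * (u ^ 6)⁻¹)) := by gcongr
    _ = _ := by ring

lemma exists_symmetrised_orbitProduct_bound {g : ℕ} (hg : 3 ≤ g) (C : ℝ) (hC : 0 ≤ C) :
    ∃ c : ℝ, 0 < c ∧ ∀ K : ℕ, 2 ≤ K → ∀ u : ℝ, 1 ≤ u → u ^ 8 = K → ∀ κ : ℝ, |κ| ≤ C →
      ∀ θ : ℝ, u ^ 6 * ((g : ℝ) ^ K)⁻¹ / (g - 1) ≤ |centred θ| →
      ∀ β : ℝ, 0 ≤ β → ((g : ℝ) - 1) * β ≤ 1 / 2 →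
        ‖eC (κ * β) * orbitProduct g K θ β + eC (κ * -β) * orbitProduct g K θ (-β)‖ ≤
          c * ((u ^ 6)⁻¹ * Real.exp (-(K / (2 * g)) * β ^ 2) + (u ^ 10)⁻¹) := by
  have hg0 : (0 : ℝ) < g := by positivity
  have hg3 : (3 : ℝ) ≤ g := by exact_mod_cast hg
  have hg2 : 2 ≤ g := by omega
  set D : ℝ := 12 * (Real.pi * g) ^ 2 + 2 * Real.pi * C with hD
  set c₁ : ℝ := Real.exp (g * D ^ 2) * (24 * g * D ^ 2 + g) with hc₁
  set c₂ : ℝ := 1 / (64 * g ^ 3) with hc₂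
  set c₃ : ℝ := (1 / (16 * g)) ^ 2 / g ^ 3 / 2 with hc₃
  have hc₁0 : 0 < c₁ := by positivity
  have hc₂0 : 0 < c₂ := by positivity
  have hc₃0 : 0 < c₃ := by positivity
  set m₂ : ℝ := (Nat.factorial 10 : ℝ) / c₂ ^ 10 with hm₂
  set m₃ : ℝ := (Nat.factorial 10 : ℝ) / c₃ ^ 10 with hm₃
  have hm₂0 : 0 < m₂ := by positivity
  have hm₃0 : 0 < m₃ := by positivity
  refine ⟨c₁ + 2 * m₂ + 2 * m₃, by positivity, fun K hK u hu huK κ hκ θ hθ β hβ0 hβ => ?_⟩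
  have hu0 : 0 < u := by linarith
  have huK' : u ≤ K := huK ▸ le_self_pow₀ hu (by norm_num)
  set X : ℝ := Real.exp (-(K / (2 * g)) * β ^ 2) with hX
  have hX0 : 0 < X := Real.exp_pos _
  have htriv : ∀ m : ℝ, 0 ≤ m → 2 * m ≤ c₁ + 2 * m₂ + 2 * m₃ →
      |orbitProduct g K θ β| ≤ m * (u ^ 10)⁻¹ → |orbitProduct g K θ (-β)| ≤ m * (u ^ 10)⁻¹ →
      ‖eC (κ * β) * orbitProduct g K θ β + eC (κ * -β) * orbitProduct g K θ (-β)‖ ≤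
        (c₁ + 2 * m₂ + 2 * m₃) * ((u ^ 6)⁻¹ * X + (u ^ 10)⁻¹) := by
    intro m hm hmc h1 h2
    refine (norm_add_le _ _).trans ?_
    rw [norm_mul, norm_mul, norm_eC, norm_eC, one_mul, one_mul, Complex.norm_real,
      Complex.norm_real, Real.norm_eq_abs, Real.norm_eq_abs]
    calc _ ≤ 2 * m * (u ^ 10)⁻¹ := by linarith
      _ ≤ (c₁ + 2 * m₂ + 2 * m₃) * (u ^ 10)⁻¹ := by gcongr
      _ ≤ _ := by
        gcongr
        exact le_add_of_nonneg_left (by positivity)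
  rcases le_total β (1 / (16 * g)) with hβs | hβl
  · have hβa : |β| ≤ 1 / (16 * g) := by rwa [abs_of_nonneg hβ0]
    set L := (farIndices g K θ).card with hL
    rcases le_total u L with huL | hLu
    · have hb : ∀ b : ℝ, |b| ≤ 1 / (16 * g) → |orbitProduct g K θ b| ≤ m₂ * (u ^ 10)⁻¹ := by
        intro b hb
        refine (abs_orbitProduct_le_exp_card_farIndices hg2 K θ hb).trans ?_
        refine le_trans ?_ (exp_neg_mul_le hc₂0 hu0 10)
        gcongr
      exact htriv m₂ hm₂0.le (by linarith) (hb β hβa) (hb (-β) (by rwa [abs_neg]))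
    · refine (norm_symmetrised_orbitProduct_le_gaussian hg2 hC hD hK hu huK hκ hθ hLu hβ0
        hβs).trans ?_
      rw [← hX, ← hc₁]
      gcongr
      · linarith
      · exact le_add_of_nonneg_right (by positivity)
  · have hb : ∀ b : ℝ, |b| = β → |orbitProduct g K θ b| ≤ m₃ * (u ^ 10)⁻¹ := by
      intro b hb
      obtain ⟨J, rfl⟩ : ∃ J, K = J + 1 := ⟨K - 1, by omega⟩
      refine (abs_orbitProduct_le_of_le_abs hg2 J θ (δ := 1 / (16 * g)) (by positivity)
        (hb ▸ hβl) (hb ▸ hβ)).trans ?_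
      refine le_trans ?_ (exp_neg_mul_le hc₃0 hu0 10)
      rw [Real.exp_le_exp, neg_le_neg_iff, hc₃, div_mul_eq_mul_div, mul_div_assoc]
      gcongr
      have : (1 : ℝ) ≤ J := by exact_mod_cast (by omega : 1 ≤ J)
      push_cast at huK'
      linarith
    exact htriv m₃ hm₃0.le (by linarith) (hb β (abs_of_nonneg hβ0))
      (hb (-β) (by rw [abs_neg, abs_of_nonneg hβ0]))

lemma exists_intCast_pow_mul_div {g : ℕ} (hg : 2 ≤ g) (j i : ℕ) :
    ∃ q : ℤ, (g : ℝ) ^ i * (j / ((g - 1 : ℕ) : ℝ)) = j / ((g - 1 : ℕ) : ℝ) + q := by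
  obtain ⟨q, hq⟩ := sub_dvd_pow_sub_pow (g : ℤ) 1 i
  have hg2 : (2 : ℝ) ≤ g := by exact_mod_cast hg
  have hm : ((g - 1 : ℕ) : ℝ) = g - 1 := by
    rw [Nat.cast_sub (by omega), Nat.cast_one]
  have hm0 : (g : ℝ) - 1 ≠ 0 := by linarith
  refine ⟨j * q, ?_⟩
  have hq' : (g : ℝ) ^ i - 1 = (g - 1) * q := by
    rw [one_pow] at hq
    exact_mod_cast hq
  have h : (g : ℝ) ^ i = (g - 1) * q + 1 := by linarith
  rw [hm, h]
  push_cast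
  field_simp
  ring

lemma exists_integrand_eq {g : ℕ} (hg : 2 ≤ g) (K : ℕ) (k : ℤ) (θ : ℝ) (j : ℕ) :
    ∃ z : ℂ, ‖z‖ = 1 ∧ ∀ β : ℝ,
      eC (-k * (j / ((g - 1 : ℕ) : ℝ) + β)) * ∏ i ∈ Finset.range K,
        digitKernel g (j / ((g - 1 : ℕ) : ℝ) + β + (g : ℝ) ^ i * θ) =
      z * (g : ℝ) ^ K * (eC ((muK g K - k) * β) *
        orbitProduct g K (θ + j / ((g - 1 : ℕ) : ℝ)) β) := by
  set s : ℝ := j / ((g - 1 : ℕ) : ℝ) with hs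
  refine ⟨eC (-k * s) *
    eC (∑ i ∈ Finset.range K, ((g : ℝ) - 1) / 2 * centred ((g : ℝ) ^ i * (θ + s))), ?_, ?_⟩
  · rw [norm_mul, norm_eC, norm_eC, one_mul]
  · intro β
    have h : ∀ i : ℕ, digitKernel g (s + β + (g : ℝ) ^ i * θ) =
        digitKernel g (β + (g : ℝ) ^ i * (θ + s)) := by
      intro i
      obtain ⟨q, hq⟩ := exists_intCast_pow_mul_div hg j i
      rw [← digitKernel_add_intCast g _ q, mul_add, hq]
      congr 1
      ring
    rw [Finset.prod_congr rfl fun i _ => h i, prod_digitKernel_eq (by omega), mul_add, eC_add,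
      (by ring : (muK g K - k) * β = -k * β + muK g K * β), eC_add (-k * β)]
    push_cast
    ring

lemma integral_gaussian_le {a w : ℝ} (ha : 0 < a) (hw : 0 ≤ w) :
    ∫ β in (0 : ℝ)..w, Real.exp (-a * β ^ 2) ≤ Real.sqrt (Real.pi / a) := by
  rw [← integral_gaussian a, intervalIntegral.integral_of_le hw]
  exact MeasureTheory.setIntegral_le_integral (integrable_exp_neg_mul_sq ha)
    (Filter.Eventually.of_forall fun _ => (Real.exp_pos _).le)

theorem statement8 (g : ℕ) (hg : 3 ≤ g) :
    ∃ c : ℝ, 0 < c ∧ ∃ K0 : ℕ, ∀ K : ℕ, K0 ≤ K →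
      ∀ k : ℤ, |(k : ℝ) - muK g K| ≤ Cg g →
      ∀ θ : ℝ, inMinorArcs g K θ →
        ‖fsum g K k θ‖ ≤ c * (g : ℝ) ^ K * (K : ℝ) ^ (-(5 : ℝ) / 4) := by
  have hg2 : 2 ≤ g := by omega
  have hg0 : (0 : ℝ) < g := by positivity
  have hm : ((g - 1 : ℕ) : ℝ) = g - 1 := by
    rw [Nat.cast_sub (by omega), Nat.cast_one]
  have hg3 : (3 : ℝ) ≤ g := by exact_mod_cast hg
  have hm2 : (2 : ℝ) ≤ ((g - 1 : ℕ) : ℝ) := by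
    rw [hm]
    linarith
  obtain ⟨c, hc, hbound⟩ := exists_symmetrised_orbitProduct_bound hg (Cg g) (Nat.cast_nonneg _)
  set A : ℝ := Real.sqrt (Real.pi * (2 * g)) + 1 with hA
  refine ⟨((g - 1 : ℕ) : ℝ) * (c * A), by positivity, 2, fun K hK k hk θ hθ => ?_⟩
  have hK0 : (0 : ℝ) < K := by positivity
  set u : ℝ := (K : ℝ) ^ ((1 : ℝ) / 8) with hu
  have hupow : ∀ n : ℕ, u ^ n = (K : ℝ) ^ ((n : ℝ) / 8) := by
    intro n
    rw [hu, ← Real.rpow_natCast, ← Real.rpow_mul hK0.le]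
    ring_nf
  have hu1 : 1 ≤ u := Real.one_le_rpow (by exact_mod_cast (by omega : 1 ≤ K)) (by norm_num)
  have hu0 : 0 < u := by linarith
  have hu8 : u ^ 8 = K := by
    rw [hupow]
    norm_num
  have hu6 : u ^ 6 = (K : ℝ) ^ ((3 : ℝ) / 4) := by
    rw [hupow]
    norm_num
  have hu10 : (u ^ 10)⁻¹ = (K : ℝ) ^ (-(5 : ℝ) / 4) := by
    rw [hupow, ← Real.rpow_neg hK0.le]
    norm_num
  rw [← hu10, fsum_eq_integral hg2]
  set b : ℝ → ℝ := fun β => (g : ℝ) ^ K *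
    (c * ((u ^ 6)⁻¹ * Real.exp (-(K / (2 * g)) * β ^ 2) + (u ^ 10)⁻¹)) with hb
  refine (norm_integral_le_of_symmetrised_bound (m := g - 1) (b := b) (by omega) ?_ ?_
    (by fun_prop) ?_).trans ?_
  · exact (continuous_eC.comp (by fun_prop)).mul
      (continuous_finsetProd _ fun i _ => (continuous_digitKernel g).comp (by fun_prop))
  · intro α
    have h1 : eC (-k * (α + 1)) = eC (-k * α) := by
      rw [← eC_add_intCast (-k * α) (-k)]
      push_cast
      ring_nf
    have h2 : ∀ i : ℕ, digitKernel g (α + 1 + (g : ℝ) ^ i * θ) =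
        digitKernel g (α + (g : ℝ) ^ i * θ) := by
      intro i
      rw [← digitKernel_add_intCast g (α + (g : ℝ) ^ i * θ) 1]
      push_cast
      ring_nf
    simp only [h1, h2]
  · intro j _ β hβ0 hβ
    obtain ⟨z, hz, hF⟩ := exists_integrand_eq hg2 K k θ j
    rw [sub_eq_add_neg, hF, hF, ← mul_add, norm_mul, norm_mul, hz, one_mul, norm_pow,
      Complex.norm_real, Real.norm_natCast]
    refine mul_le_mul_of_nonneg_left (hbound K hK u hu1 hu8 _ ?_ _ ?_ β hβ0 ?_) (by positivity)
    · rwa [abs_sub_comm]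
    · have h := (hθ (round (θ + j / ((g - 1 : ℕ) : ℝ)) * ((g - 1 : ℕ) : ℤ) - j)).le
      rw [epsK, ← hu6] at h
      refine h.trans (le_of_eq ?_)
      rw [centred]
      congr 1
      have : (g : ℝ) - 1 ≠ 0 := by linarith
      push_cast [hm]
      field_simp
      ring
    · rw [← hm]
      calc _ ≤ ((g - 1 : ℕ) : ℝ) * (1 / (2 * ((g - 1 : ℕ) : ℝ))) := by gcongr
        _ = 1 / 2 := by field_simp
  · set w : ℝ := 1 / (2 * ((g - 1 : ℕ) : ℝ)) with hw
    have hw0 : 0 ≤ w := by positivity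
    have hw1 : w ≤ 1 := by
      rw [hw, div_le_one (by positivity)]
      linarith
    have hgauss : ∫ β in (0 : ℝ)..w, Real.exp (-(K / (2 * g)) * β ^ 2) ≤
        Real.sqrt (Real.pi * (2 * g)) * (u ^ 4)⁻¹ := by
      refine (integral_gaussian_le (by positivity) hw0).trans (le_of_eq ?_)
      rw [div_div_eq_mul_div, Real.sqrt_div (by positivity), ← hu8,
        (by ring : u ^ 8 = (u ^ 4) ^ 2), Real.sqrt_sq (by positivity), div_eq_mul_inv]
    have hint : ∫ β in (0 : ℝ)..w, b β = (g : ℝ) ^ K * (c * ((u ^ 6)⁻¹ *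
        (∫ β in (0 : ℝ)..w, Real.exp (-(K / (2 * g)) * β ^ 2)) + w * (u ^ 10)⁻¹)) := by
      have hcont : Continuous fun β : ℝ => (u ^ 6)⁻¹ * Real.exp (-(K / (2 * g)) * β ^ 2) := by
        fun_prop
      rw [hb, intervalIntegral.integral_const_mul, intervalIntegral.integral_const_mul,
        intervalIntegral.integral_add (hcont.intervalIntegrable _ _)
          (continuous_const.intervalIntegrable _ _),
        intervalIntegral.integral_const_mul, intervalIntegral.integral_const, sub_zero,
        smul_eq_mul]
    rw [hint]
    calc _ ≤ ((g - 1 : ℕ) : ℝ) * ((g : ℝ) ^ K * (c * ((u ^ 6)⁻¹ *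
          (Real.sqrt (Real.pi * (2 * g)) * (u ^ 4)⁻¹) + 1 * (u ^ 10)⁻¹))) := by gcongr
      _ = _ := by
        rw [hA]
        field_simp
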